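/- A decomposable n-vector field P (nowhere a non-simple form) on M is a Nambu-Poisson tensor if and only if the distribution D = span(im ♯_P) is involutive on the open set of points where P does not vanish. -/

import Mathlib

/-- The `n`-ary bracket induced by an `n`-vector field `P`. -/
noncomputable def nbr {E : Type*} [NormedAddCommGroup E] [NormedSpace ℝ E] {n : ℕ}
    (P : E → ((E →L[ℝ] ℝ) [⋀^Fin n]→ₗ[ℝ] ℝ)) (f : Fin n → E → ℝ) (x : E) : ℝ :=
  P x fun i => fderiv ℝ (f i) x

/-- Smoothness of an `n`-vector field. -/
def SmoothNV {E : Type*} [NormedAddCommGroup E] [NormedSpace ℝ E] {n : ℕ}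
    (P : E → ((E →L[ℝ] ℝ) [⋀^Fin n]→ₗ[ℝ] ℝ)) : Prop :=
  ∀ α : Fin n → E →L[ℝ] ℝ, ContDiff ℝ (⊤ : ℕ∞) fun x => P x α

/-- `P` is a Nambu-Poisson tensor: the fundamental identity holds. -/
def IsNambu {E : Type*} [NormedAddCommGroup E] [NormedSpace ℝ E] {n : ℕ}
    (P : E → ((E →L[ℝ] ℝ) [⋀^Fin (n + 1)]→ₗ[ℝ] ℝ)) : Prop :=
  ∀ (f : Fin n → E → ℝ) (g : Fin (n + 1) → E → ℝ),
    (∀ i, ContDiff ℝ (⊤ : ℕ∞) (f i)) → (∀ i, ContDiff ℝ (⊤ : ℕ∞) (g i)) →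
    nbr P (Fin.snoc f (nbr P g)) =
      ∑ k, nbr P (Function.update g k (nbr P (Fin.snoc f (g k))))

/-- The distribution `D = span (im ♯_P)` at `x`: the span of the vectors `v` such that
`⟨β, v⟩ = P(α₁,…,αₙ,β)` for some covectors `α₁,…,αₙ` and all `β`. -/
def Dspan {E : Type*} [NormedAddCommGroup E] [NormedSpace ℝ E] {n : ℕ}
    (P : E → ((E →L[ℝ] ℝ) [⋀^Fin (n + 1)]→ₗ[ℝ] ℝ)) (x : E) : Submodule ℝ E :=
  Submodule.span ℝ
    {v : E | ∃ α : Fin n → E →L[ℝ] ℝ, ∀ β : E →L[ℝ] ℝ, β v = P x (Fin.snoc α β)}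

/-- The determinant as an alternating map in the rows. -/
noncomputable def dA (N : ℕ) : (Fin N → ℝ) [⋀^Fin N]→ₗ[ℝ] ℝ := Matrix.detRowAlternating

lemma alt_row_expand {N : ℕ} {ι : Type*} [Fintype ι] [DecidableEq ι] (A : (ι → ℝ) [⋀^Fin N]→ₗ[ℝ] ℝ)
    (M : Fin N → ι → ℝ) (k : Fin N) (r : ι → ℝ) :
    A (Function.update M k r) = ∑ l, r l * A (Function.update M k (Pi.single l 1)) := by
  have h := LinearMap.pi_apply_eq_sum_univ (A.toMultilinearMap.toLinearMap M k) r
  simp only [MultilinearMap.toLinearMap_apply, smul_eq_mul] at h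
  refine h.trans (Finset.sum_congr rfl fun l _ => ?_)
  have : (fun j => if l = j then (1 : ℝ) else 0) = Pi.single l 1 := by
    ext j; simp [Pi.single_apply, eq_comm]
  rw [this]; rfl

lemma alt_snoc_expand {n : ℕ} {ι : Type*} [Fintype ι] [DecidableEq ι]
    (A : (ι → ℝ) [⋀^Fin (n+1)]→ₗ[ℝ] ℝ)
    (F : Fin n → ι → ℝ) (r : ι → ℝ) :
    A (Fin.snoc F r) = ∑ l, r l * A (Fin.snoc F (Pi.single l 1)) := by
  have := alt_row_expand A (Fin.snoc F 0) (Fin.last n) r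
  simpa only [Fin.update_snoc_last] using this

lemma dA_trace {N : ℕ} (G : Fin N → Fin N → ℝ) (B : Fin N → Fin N → ℝ) :
    ∑ k, dA N (Function.update G k (fun j => ∑ l, G k l * B j l)) = (∑ j, B j j) * dA N G := by
  have h1 : ∀ k l, dA N (Function.update G k (Pi.single l 1)) = Matrix.adjugate (Matrix.of G) l k := by
    intro k l
    rw [Matrix.adjugate_apply]; rfl
  have h2 : Matrix.trace (Matrix.of G * (Matrix.of B).transpose * Matrix.adjugate (Matrix.of G))
      = (∑ j, B j j) * dA N G := by
    rw [Matrix.trace_mul_comm, ← Matrix.mul_assoc, Matrix.adjugate_mul]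
    simp [Matrix.trace, dA, Matrix.det, Finset.sum_mul, mul_comm]
    rfl
  rw [← h2]
  simp only [Matrix.trace, Matrix.diag_apply]
  refine Finset.sum_congr rfl fun k _ => ?_
  rw [alt_row_expand, Matrix.mul_apply]
  simp [h1, Matrix.mul_apply]

lemma dA_antisymm {n : ℕ} (F : Fin n → Fin (n+1) → ℝ) (i : Fin n)
    (H : Fin (n+1) → Fin (n+1) → ℝ) (hH : ∀ j l, H j l = H l j) :
    ∑ j, dA (n+1) (Fin.snoc (Function.update F i (H j)) (Pi.single j 1)) = 0 := by
  set q : Fin (n+1) → Fin (n+1) → ℝ := fun j l =>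
    dA (n+1) (Fin.snoc (Function.update F i (Pi.single l 1)) (Pi.single j 1)) with hq
  have h1 : ∀ j, dA (n+1) (Fin.snoc (Function.update F i (H j)) (Pi.single j 1))
      = ∑ l, H j l * q j l := by
    intro j
    simp only [hq, Fin.snoc_update]
    exact alt_row_expand _ _ _ _
  have h2 : ∀ j l, q j l = - q l j := by
    intro j l
    simp only [hq]
    rw [← AlternatingMap.map_swap _ _ (i := i.castSucc) (j := Fin.last n) (Fin.castSucc_lt_last i).ne]
    congr 1
    ext k
    refine Fin.lastCases ?_ (fun k => ?_) k
    · simp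
    · by_cases hk : k = i
      · subst hk; simp [-Fin.snoc_update]
      · have : (Equiv.swap i.castSucc (Fin.last n)) k.castSucc = k.castSucc :=
          Equiv.swap_apply_of_ne_of_ne (by simpa using hk) (Fin.castSucc_lt_last k).ne
        simp [this, hk]
  simp only [h1]
  have h3 : ∑ j, ∑ l, H j l * q j l = - ∑ j, ∑ l, H j l * q j l := by
    conv_lhs => rw [Finset.sum_comm]
    rw [← Finset.sum_neg_distrib]
    refine Finset.sum_congr rfl fun j _ => ?_
    rw [← Finset.sum_neg_distrib]
    refine Finset.sum_congr rfl fun l _ => ?_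
    rw [hH l j, h2 l j]; ring
  linarith

lemma key_algebra {n : ℕ} (p : ℝ) (dp : Fin (n+1) → ℝ) (F : Fin n → Fin (n+1) → ℝ)
    (F2 : Fin n → Fin (n+1) → Fin (n+1) → ℝ) (G : Fin (n+1) → Fin (n+1) → ℝ)
    (G2 : Fin (n+1) → Fin (n+1) → Fin (n+1) → ℝ)
    (hF : ∀ i j l, F2 i j l = F2 i l j) (hG : ∀ i j l, G2 i j l = G2 i l j) :
    dA (n+1) (Fin.snoc F (fun j => dp j * dA (n+1) G
      + p * ∑ k, dA (n+1) (Function.update G k (G2 k j)))) =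
    ∑ k, dA (n+1) (Function.update G k (fun j => dp j * dA (n+1) (Fin.snoc F (G k))
      + p * (∑ i, dA (n+1) (Fin.snoc (Function.update F i (F2 i j)) (G k))
          + dA (n+1) (Fin.snoc F (G2 k j))))) := by
  set c : Fin (n+1) → ℝ := fun l => dA (n+1) (Fin.snoc F (Pi.single l 1)) with hc
  have hcr : ∀ r, dA (n+1) (Fin.snoc F r) = ∑ l, r l * c l := fun r => alt_snoc_expand _ _ _
  have e1 : ∀ k, dA (n+1) (Function.update G k (fun j => dp j * dA (n+1) (Fin.snoc F (G k))
      + p * (∑ i, dA (n+1) (Fin.snoc (Function.update F i (F2 i j)) (G k))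
          + dA (n+1) (Fin.snoc F (G2 k j))))) =
      dA (n+1) (Function.update G k (fun j => ∑ l, G k l * (dp j * c l)))
      + p * (dA (n+1) (Function.update G k (fun j => ∑ l, G k l *
          ∑ i, dA (n+1) (Fin.snoc (Function.update F i (F2 i j)) (Pi.single l 1))))
        + ∑ j, c j * dA (n+1) (Function.update G k (G2 k j))) := by
    intro k
    have e2 : (fun j => dp j * dA (n+1) (Fin.snoc F (G k))
      + p * (∑ i, dA (n+1) (Fin.snoc (Function.update F i (F2 i j)) (G k))
          + dA (n+1) (Fin.snoc F (G2 k j)))) =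
       (fun j => ∑ l, G k l * (dp j * c l)) + p • ((fun j => ∑ l, G k l *
          ∑ i, dA (n+1) (Fin.snoc (Function.update F i (F2 i j)) (Pi.single l 1)))
          + ∑ j, c j • G2 k j) := by
      ext j
      simp only [hcr, Pi.add_apply, Pi.smul_apply, Finset.sum_apply, smul_eq_mul]
      congr 1
      · rw [Finset.mul_sum]; exact Finset.sum_congr rfl fun l _ => by ring
      · congr 2
        · simp only [Finset.mul_sum]
          rw [Finset.sum_comm]
          refine Finset.sum_congr rfl fun i _ => ?_
          exact alt_snoc_expand _ _ _
        · exact Finset.sum_congr rfl fun l _ => by rw [hG k j l]; ring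
    rw [e2]
    have e3 : dA (n+1) (Function.update G k (∑ j, c j • G2 k j)) =
        ∑ j, c j * dA (n+1) (Function.update G k (G2 k j)) := by
      have := map_sum ((dA (n+1)).toMultilinearMap.toLinearMap G k) (fun j => c j • G2 k j) Finset.univ
      simp only [map_smul, smul_eq_mul] at this
      exact this
    rw [AlternatingMap.map_update_add, AlternatingMap.map_update_smul, AlternatingMap.map_update_add, e3,
      smul_eq_mul]
  rw [Finset.sum_congr rfl fun k _ => e1 k]
  rw [Finset.sum_add_distrib, ← Finset.mul_sum, Finset.sum_add_distrib, dA_trace, dA_trace]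
  have e4 : ∑ j, ∑ i, dA (n+1) (Fin.snoc (Function.update F i (F2 i j)) (Pi.single j 1)) = 0 := by
    rw [Finset.sum_comm]
    exact Finset.sum_eq_zero fun i _ => dA_antisymm F i (F2 i) (hF i)
  rw [e4, zero_mul, zero_add, hcr]
  simp only [add_mul, Finset.sum_add_distrib, Finset.sum_mul, Finset.mul_sum]
  congr 1
  · exact Finset.sum_congr rfl fun l _ => by ring
  · rw [Finset.sum_comm]
    exact Finset.sum_congr rfl fun l _ => Finset.sum_congr rfl fun l _ => by ring

section
variable {E : Type*} [NormedAddCommGroup E] [NormedSpace ℝ E]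

lemma exS {N : ℕ} (A : (E →L[ℝ] ℝ) [⋀^Fin N]→ₗ[ℝ] ℝ) (v : Fin N → E)
    (hA : ∀ α : Fin N → E →L[ℝ] ℝ, A α = Matrix.det (Matrix.of fun i j => α i (v j)))
    (y : Fin N → E →L[ℝ] ℝ) (j : Fin N) :
    ∃ w : E, ∀ β : E →L[ℝ] ℝ, β w = A (Function.update y j β) := by
  refine ⟨∑ l, dA N (Function.update (fun i l => y i (v l)) j (Pi.single l 1)) • v l, fun β => ?_⟩
  have h : (fun i l => (Function.update y j β) i (v l)) =
      Function.update (fun i l => y i (v l)) j (fun l => β (v l)) := by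
    ext i l
    by_cases hi : i = j
    · subst hi; simp
    · simp [hi]
  have h2 : A (Function.update y j β) = dA N (fun i l => (Function.update y j β) i (v l)) := by
    rw [hA]; rfl
  rw [h2, h, alt_row_expand]
  simp [mul_comm]

lemma key_formula {N : ℕ} (A : (E →L[ℝ] ℝ) [⋀^Fin N]→ₗ[ℝ] ℝ) (v : Fin N → E)
    (hA : ∀ α : Fin N → E →L[ℝ] ℝ, A α = Matrix.det (Matrix.of fun i j => α i (v j)))
    (y : Fin N → E →L[ℝ] ℝ) (hy : A y ≠ 0) (W : Fin N → E)
    (hW : ∀ j, ∀ β : E →L[ℝ] ℝ, β (W j) = (A y)⁻¹ * A (Function.update y j β))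
    (α : Fin N → E →L[ℝ] ℝ) :
    A α = A y * dA N (fun i j => α i (W j)) := by
  set M : Matrix (Fin N) (Fin N) ℝ := Matrix.of fun i j => y i (v j) with hM
  set Q : Matrix (Fin N) (Fin N) ℝ := Matrix.of fun i j => α i (v j) with hQ
  have hdet : M.det ≠ 0 := by rw [← hA]; exact hy
  have h1 : (Matrix.of fun i j => α i (W j)) = Q * M⁻¹ := by
    ext i j
    rw [Matrix.of_apply, hW, Matrix.inv_def, Ring.inverse_eq_inv', Matrix.mul_smul, Matrix.smul_apply,
      hA y, smul_eq_mul]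
    congr 1
    have h : (fun k l => (Function.update y j (α i)) k (v l)) =
        Function.update (fun i l => y i (v l)) j (fun l => α i (v l)) := by
      ext k l
      by_cases hi : k = j
      · subst hi; simp
      · simp [hi]
    have h2 : A (Function.update y j (α i)) = dA N (fun k l => (Function.update y j (α i)) k (v l)) := by
      rw [hA]; rfl
    rw [h2, h, alt_row_expand, Matrix.mul_apply]
    refine Finset.sum_congr rfl fun l _ => ?_
    rw [Matrix.adjugate_apply]; rfl
  have h3 : dA N (fun i j => α i (W j)) = (Q * M⁻¹).det := by rw [← h1]; rfl
  rw [h3, Matrix.det_mul, Matrix.det_nonsing_inv, Ring.inverse_eq_inv', hA, hA]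
  change Q.det = M.det * (Q.det * M.det⁻¹)
  field_simp

lemma alt_perm {n : ℕ} (y : Fin (n+1) → E →L[ℝ] ℝ) (j : Fin (n+1)) :
    ∃ ε : ℝ, ∃ α : Fin n → E →L[ℝ] ℝ, ∀ (A : (E →L[ℝ] ℝ) [⋀^Fin (n+1)]→ₗ[ℝ] ℝ) (β : E →L[ℝ] ℝ),
      A (Function.update y j β) = ε * A (Fin.snoc α β) := by
  set σ := Equiv.swap j (Fin.last n) with hσ
  refine ⟨((Equiv.Perm.sign σ : ℤˣ) : ℤ), Fin.init (y ∘ σ), fun A β => ?_⟩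
  have h1 : (Fin.snoc (Fin.init (y ∘ σ)) β : Fin (n+1) → E →L[ℝ] ℝ) = Function.update y j β ∘ σ := by
    rw [Function.update_comp_equiv, hσ, Equiv.symm_swap, Equiv.swap_apply_left]
    nth_rewrite 2 [← Fin.snoc_init_self (y ∘ σ)]
    rw [Fin.update_snoc_last]
  rw [h1, AlternatingMap.map_perm, Units.smul_def, zsmul_eq_mul, ← mul_assoc, ← Int.cast_mul,
    ← Units.val_mul, Int.units_mul_self]
  simp

lemma Dspan_mem {n : ℕ} (P : E → ((E →L[ℝ] ℝ) [⋀^Fin (n + 1)]→ₗ[ℝ] ℝ)) (x : E)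
    (y : Fin (n+1) → E →L[ℝ] ℝ) (j : Fin (n+1)) (w : E)
    (hw : ∀ β : E →L[ℝ] ℝ, β w = P x (Function.update y j β)) (T : (Fin n → E →L[ℝ] ℝ) → E)
    (hT : ∀ α, ∀ β : E →L[ℝ] ℝ, β (T α) = P x (Fin.snoc α β)) : w ∈ Dspan P x := by
  obtain ⟨ε, α, h⟩ := alt_perm y j
  have : w = ε • T α := by
    rw [SeparatingDual.eq_iff_forall_dual_eq (R := ℝ)]
    intro β
    rw [map_smul, smul_eq_mul, hT, hw, h]
  rw [this]
  exact Submodule.smul_mem _ _ (Submodule.subset_span ⟨α, hT α⟩)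

lemma Dspan_repr {n : ℕ} (P : E → ((E →L[ℝ] ℝ) [⋀^Fin (n + 1)]→ₗ[ℝ] ℝ)) (x : E) (v : Fin (n+1) → E)
    (hA : ∀ α : Fin (n+1) → E →L[ℝ] ℝ, P x α = Matrix.det (Matrix.of fun i j => α i (v j)))
    (y : Fin (n+1) → E →L[ℝ] ℝ) (hy : P x y ≠ 0) (W : Fin (n+1) → E)
    (hW : ∀ j, ∀ β : E →L[ℝ] ℝ, β (W j) = (P x y)⁻¹ * P x (Function.update y j β))
    (w : E) (hw : w ∈ Dspan P x) : w = ∑ j, y j w • W j := by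
  induction hw using Submodule.span_induction with
  | zero => simp
  | add a b _ _ ha hb =>
    simp only [map_add, add_smul, Finset.sum_add_distrib]
    rw [← ha, ← hb]
  | smul c a _ ha =>
    simp only [map_smul, smul_assoc, ← Finset.smul_sum]
    rw [← ha]
  | mem w hw =>
    obtain ⟨α, hα⟩ := hw
    rw [SeparatingDual.eq_iff_forall_dual_eq (R := ℝ)]
    intro β
    have hk := key_formula (P x) v hA y hy W hW
    have hs : ∀ γ : E →L[ℝ] ℝ, P x (Fin.snoc α γ) = P x y *
        dA (n+1) (Fin.snoc (fun i j => α i (W j)) (fun j => γ (W j))) := by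
      intro γ
      rw [hk]
      congr 2
      exact (Fin.comp_snoc (fun (δ : E →L[ℝ] ℝ) (j : Fin (n+1)) => δ (W j)) α γ)
    have hd : ∀ k, (fun j => y k (W j)) = Pi.single k (1 : ℝ) := by
      intro k
      ext j
      rw [hW]
      by_cases h : j = k
      · subst h; simp [hy]
      · rw [AlternatingMap.map_update_self _ _ h]; simp [h]
    rw [hα, hs, alt_snoc_expand, Finset.mul_sum, map_sum]
    refine Finset.sum_congr rfl fun k _ => ?_
    rw [map_smul, hα, hs, hd, smul_eq_mul]
    ring

lemma bracket_mem {ι : Type*} [Fintype ι] (D : Submodule ℝ E) (x : E) (S : ι → E → E) (a b : ι → E → ℝ)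
    (hS : ∀ i, DifferentiableAt ℝ (S i) x) (ha : ∀ i, DifferentiableAt ℝ (a i) x)
    (hb : ∀ i, DifferentiableAt ℝ (b i) x) (hD : ∀ i, S i x ∈ D)
    (hbr : ∀ i j, fderiv ℝ (S j) x (S i x) - fderiv ℝ (S i) x (S j x) ∈ D)
    (X Y : E → E) (hX : X =ᶠ[nhds x] fun z => ∑ i, a i z • S i z)
    (hY : Y =ᶠ[nhds x] fun z => ∑ i, b i z • S i z) :
    fderiv ℝ Y x (X x) - fderiv ℝ X x (Y x) ∈ D := by
  have hf : ∀ c : ι → E → ℝ, (∀ i, DifferentiableAt ℝ (c i) x) → ∀ v,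
      fderiv ℝ (fun z => ∑ i, c i z • S i z) x v =
        ∑ i, (c i x • fderiv ℝ (S i) x v) + ∑ i, fderiv ℝ (c i) x v • S i x := by
    intro c hc v
    rw [fderiv_fun_sum (A := fun i z => c i z • S i z) fun i _ => (hc i).smul (hS i)]
    simp only [fderiv_fun_smul (hc _) (hS _)]
    simp [Finset.sum_add_distrib]
  rw [hX.fderiv_eq, hY.fderiv_eq, hf _ ha, hf _ hb, hX.eq_of_nhds, hY.eq_of_nhds]
  have e : ∀ p q r s : E, (p + q) - (r + s) = (p - r) + (q - s) := by intros; abel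
  rw [e]
  refine D.add_mem ?_ (D.sub_mem (D.sum_mem fun i _ => D.smul_mem _ (hD i))
    (D.sum_mem fun i _ => D.smul_mem _ (hD i)))
  have e1 : ∑ i, b i x • fderiv ℝ (S i) x (∑ i, a i x • S i x) -
      ∑ i, a i x • fderiv ℝ (S i) x (∑ i, b i x • S i x) =
      ∑ i, ∑ j, (a i x * b j x) • (fderiv ℝ (S j) x (S i x) - fderiv ℝ (S i) x (S j x)) := by
    simp only [map_sum, map_smul, smul_sub, Finset.sum_sub_distrib, Finset.smul_sum, smul_smul]
    congr 1
    rw [Finset.sum_comm]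
    simp only [mul_comm]
  rw [e1]
  exact D.sum_mem fun i _ => D.sum_mem fun j _ => D.smul_mem _ (hbr i j)

lemma smooth_of_dual [FiniteDimensional ℝ E] (S : E → E)
    (h : ∀ β : E →L[ℝ] ℝ, ContDiff ℝ (⊤ : ℕ∞) fun x => β (S x)) : ContDiff ℝ (⊤ : ℕ∞) S := by
  let b := Module.finBasis ℝ E
  have : S = fun x => ∑ i, (LinearMap.toContinuousLinearMap (b.coord i)) (S x) • b i := by
    ext x
    simp [b.sum_repr]
  rw [this]
  exact ContDiff.sum fun i _ => (h _).smul contDiff_const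

lemma dA_hasFDerivAt {N : ℕ} (M : Fin N → E → Fin N → ℝ) (x : E)
    (hM : ∀ i, DifferentiableAt ℝ (M i) x) :
    DifferentiableAt ℝ (fun z => dA N (fun i => M i z)) x ∧
    ∀ w, fderiv ℝ (fun z => dA N (fun i => M i z)) x w =
      ∑ k, dA N (Function.update (fun i => M i x) k (fderiv ℝ (M k) x w)) := by
  let c : ContinuousMultilinearMap ℝ (fun _ : Fin N => Fin N → ℝ) ℝ :=
    { (dA N).toMultilinearMap with
      cont := by
        change Continuous (fun M : Matrix (Fin N) (Fin N) ℝ => M.det)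
        exact Continuous.matrix_det continuous_id }
  have h := HasFDerivAt.multilinear_comp (f := c) (g := M) (fun i => (hM i).hasFDerivAt)
  refine ⟨h.differentiableAt, fun w => ?_⟩
  have h2 := h.fderiv
  have h3 : fderiv ℝ (fun z => dA N (fun i => M i z)) x = _ := h2
  rw [h3, sum_apply]
  rfl
end

section
variable {E : Type*} [NormedAddCommGroup E] [NormedSpace ℝ E]

lemma nbr_snoc {n : ℕ} (P : E → ((E →L[ℝ] ℝ) [⋀^Fin (n + 1)]→ₗ[ℝ] ℝ)) (f : Fin n → E → ℝ)
    (φ : E → ℝ) (x : E) :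
    nbr P (Fin.snoc f φ) x = P x (Fin.snoc (fun i => fderiv ℝ (f i) x) (fderiv ℝ φ x)) := by
  unfold nbr
  congr 1
  exact Fin.comp_snoc (fun φ : E → ℝ => fderiv ℝ φ x) f φ

lemma nbr_update {n : ℕ} (P : E → ((E →L[ℝ] ℝ) [⋀^Fin n]→ₗ[ℝ] ℝ)) (g : Fin n → E → ℝ)
    (k : Fin n) (φ : E → ℝ) (x : E) :
    nbr P (Function.update g k φ) x =
      P x (Function.update (fun i => fderiv ℝ (g i) x) k (fderiv ℝ φ x)) := by
  unfold nbr
  congr 1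
  ext i : 1
  exact Function.apply_update (fun _ (φ : E → ℝ) => fderiv ℝ φ x) g k φ i

lemma nambu_bracket {n : ℕ} (P : E → ((E →L[ℝ] ℝ) [⋀^Fin (n + 1)]→ₗ[ℝ] ℝ)) (hN : IsNambu P)
    (T : (Fin n → E →L[ℝ] ℝ) → E → E)
    (hT : ∀ α x, ∀ β : E →L[ℝ] ℝ, β (T α x) = P x (Fin.snoc α β))
    (hTs : ∀ α, ContDiff ℝ (⊤ : ℕ∞) (T α)) (α γ : Fin n → E →L[ℝ] ℝ) (x : E) :
    fderiv ℝ (T γ) x (T α x) - fderiv ℝ (T α) x (T γ x) =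
      ∑ i, T (Function.update γ i ((γ i) ∘L fderiv ℝ (T α) x)) x := by
  have hTd : ∀ α, DifferentiableAt ℝ (T α) x := fun α =>
    ((hTs α).differentiable (by simp)).differentiableAt
  rw [SeparatingDual.eq_iff_forall_dual_eq (R := ℝ)]
  intro h
  set g : Fin (n+1) → E →L[ℝ] ℝ := Fin.snoc γ h with hg
  have key := congrFun (hN (fun i => ⇑(α i)) (fun i => ⇑(g i)) (fun i => (α i).contDiff)
    (fun i => (g i).contDiff)) x
  have e1 : nbr P (fun i => ⇑(g i)) = fun z => h (T γ z) := by
    ext z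
    rw [hT]
    unfold nbr
    simp only [ContinuousLinearMap.fderiv, hg]
  have e2 : ∀ β : E →L[ℝ] ℝ, nbr P (Fin.snoc (fun i => ⇑(α i)) ⇑β) = fun z => β (T α z) := by
    intro β
    ext z
    rw [hT, nbr_snoc]
    simp only [ContinuousLinearMap.fderiv]
  have e3 : ∀ (β : E →L[ℝ] ℝ) α, fderiv ℝ (fun z => β (T α z)) x = β ∘L fderiv ℝ (T α) x := by
    intro β α
    exact (β.hasFDerivAt.comp x (hTd α).hasFDerivAt).fderiv
  simp only [e1, e2, Finset.sum_apply, nbr_snoc, nbr_update, e3, ContinuousLinearMap.fderiv] at key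
  rw [← hT, Fin.sum_univ_castSucc] at key
  have e4 : (fun i => g i) = Fin.snoc γ h := rfl
  simp only [e4, hg, Fin.snoc_castSucc, Fin.snoc_last, Fin.update_snoc_last, ← Fin.snoc_update, ← hT] at key
  simp only [ContinuousLinearMap.comp_apply] at key
  rw [map_sub, map_sum, key]
  ring

lemma fi_at {n : ℕ} (P : E → ((E →L[ℝ] ℝ) [⋀^Fin (n + 1)]→ₗ[ℝ] ℝ)) (x : E)
    (p : E → ℝ) (W : Fin (n+1) → E → E) (hp : DifferentiableAt ℝ p x)
    (hW : ∀ j, DifferentiableAt ℝ (W j) x)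
    (hform : ∀ᶠ z in nhds x, ∀ α, P z α = p z * dA (n+1) (fun i j => α i (W j z)))
    (hcomm : ∀ i j, fderiv ℝ (W j) x (W i x) = fderiv ℝ (W i) x (W j x))
    (f : Fin n → E → ℝ) (g : Fin (n + 1) → E → ℝ)
    (hf : ∀ i, ContDiff ℝ (⊤ : ℕ∞) (f i)) (hg : ∀ i, ContDiff ℝ (⊤ : ℕ∞) (g i)) :
    nbr P (Fin.snoc f (nbr P g)) x =
      ∑ k, nbr P (Function.update g k (nbr P (Fin.snoc f (g k)))) x := by
  -- frame derivative and second frame derivative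
  let d1 : (E → ℝ) → E → Fin (n+1) → ℝ := fun φ z j => fderiv ℝ φ z (W j z)
  let d2 : (E → ℝ) → Fin (n+1) → Fin (n+1) → ℝ := fun φ j => fderiv ℝ (d1 φ) x (W j x)
  have hφ2 : ∀ φ : E → ℝ, ContDiff ℝ (⊤ : ℕ∞) φ → DifferentiableAt ℝ (fderiv ℝ φ) x := by
    intro φ h
    exact ((h.fderiv_right (m := 1) (by norm_cast)).differentiable (by simp)).differentiableAt
  have hd1c : ∀ φ : E → ℝ, ContDiff ℝ (⊤ : ℕ∞) φ → ∀ j,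
      DifferentiableAt ℝ (fun z => d1 φ z j) x := fun φ h j => (hφ2 φ h).clm_apply (hW j)
  have hd1 : ∀ φ : E → ℝ, ContDiff ℝ (⊤ : ℕ∞) φ → DifferentiableAt ℝ (d1 φ) x := fun φ h =>
    differentiableAt_pi.2 (hd1c φ h)
  have hsymm : ∀ φ : E → ℝ, ContDiff ℝ (⊤ : ℕ∞) φ → ∀ j l, d2 φ j l = d2 φ l j := by
    intro φ h j l
    have hs : IsSymmSndFDerivAt ℝ φ x := h.contDiffAt.isSymmSndFDerivAt (by simp; norm_cast)
    have e : ∀ j l, d2 φ j l = fderiv ℝ φ x (fderiv ℝ (W l) x (W j x))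
        + fderiv ℝ (fderiv ℝ φ) x (W j x) (W l x) := by
      intro j l
      have : d2 φ j l = fderiv ℝ (fun z => d1 φ z l) x (W j x) := by
        change fderiv ℝ (d1 φ) x (W j x) l = _
        rw [fderiv_pi (hd1c φ h)]; rfl
      rw [this]
      change fderiv ℝ (fun z => fderiv ℝ φ z (W l z)) x (W j x) = _
      rw [fderiv_clm_apply (hφ2 φ h) (hW l)]
      simp
    rw [e, e, hcomm, hs.eq]
  -- derivative of the bracket
  have hbr : ∀ h : Fin (n+1) → E → ℝ, (∀ i, ContDiff ℝ (⊤ : ℕ∞) (h i)) → ∀ j,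
      d1 (nbr P h) x j = fderiv ℝ p x (W j x) * dA (n+1) (fun i => d1 (h i) x)
        + p x * ∑ k, dA (n+1) (Function.update (fun i => d1 (h i) x) k (d2 (h k) j)) := by
    intro h hh j
    have e : nbr P h =ᶠ[nhds x] fun z => p z * dA (n+1) (fun i => d1 (h i) z) := by
      filter_upwards [hform] with z hz
      exact hz _
    obtain ⟨hd, hd'⟩ := dA_hasFDerivAt (fun i => d1 (h i)) x (fun i => hd1 _ (hh i))
    change fderiv ℝ (nbr P h) x (W j x) = _
    rw [e.fderiv_eq, fderiv_fun_mul hp hd]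
    simp only [ContinuousLinearMap.add_apply, ContinuousLinearMap.smul_apply, hd', smul_eq_mul]
    rw [add_comm, mul_comm (dA (n+1) _)]
  have hx := hform.self_of_nhds
  set F : Fin n → Fin (n+1) → ℝ := fun i => d1 (f i) x
  set G : Fin (n+1) → Fin (n+1) → ℝ := fun i => d1 (g i) x
  have hsn : ∀ φ : E → ℝ, nbr P (Fin.snoc f φ) x = p x * dA (n+1) (Fin.snoc F (d1 φ x)) := by
    intro φ
    unfold nbr
    rw [hx]
    congr 2
    exact Fin.comp_snoc (fun φ => d1 φ x) f φ
  have hup : ∀ k (φ : E → ℝ), nbr P (Function.update g k φ) x =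
      p x * dA (n+1) (Function.update G k (d1 φ x)) := by
    intro k φ
    unfold nbr
    rw [hx]
    congr 2
    ext i : 1
    exact Function.apply_update (fun _ φ => d1 φ x) g k φ i
  have hin : ∀ k j, d1 (nbr P (Fin.snoc f (g k))) x j =
      fderiv ℝ p x (W j x) * dA (n+1) (Fin.snoc F (G k))
      + p x * (∑ i, dA (n+1) (Fin.snoc (Function.update F i (d2 (f i) j)) (G k))
          + dA (n+1) (Fin.snoc F (d2 (g k) j))) := by
    intro k j
    rw [hbr]
    · have e : (fun i => d1 ((Fin.snoc f (g k) : Fin (n+1) → E → ℝ) i) x) = Fin.snoc F (G k) :=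
        Fin.comp_snoc (fun φ => d1 φ x) f (g k)
      rw [e, Fin.sum_univ_castSucc]
      simp only [Fin.snoc_castSucc, Fin.snoc_last, Fin.update_snoc_last, ← Fin.snoc_update]
    · intro i
      refine Fin.lastCases ?_ (fun i => ?_) i
      · simpa using hg k
      · simpa using hf i
  simp only [hsn, hup]
  rw [← Finset.mul_sum]
  congr 1
  have k := key_algebra (p x) (fun j => fderiv ℝ p x (W j x)) F (fun i => d2 (f i)) G
    (fun i => d2 (g i)) (fun i => hsymm _ (hf i)) (fun i => hsymm _ (hg i))
  have e1 : d1 (nbr P g) x = _ := funext fun j => hbr g hg j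
  have e2 : ∀ k, d1 (nbr P (Fin.snoc f (g k))) x = _ := fun k => funext fun j => hin k j
  simp only [e1, e2]
  exact k
end

/-- An everywhere decomposable `(n+1)`-vector field `P` (`n + 1 ≥ 3`) is a
Nambu-Poisson tensor iff the distribution `D = span (im ♯_P)` is involutive on the open
set of points where `P ≠ 0`. The Lie bracket of vector fields `X, Y : E → E` is
`[X,Y](x) = DY(x)·X(x) − DX(x)·Y(x)`. -/
theorem decomposable_isNambu_iff_involutive
    {E : Type*} [NormedAddCommGroup E] [NormedSpace ℝ E] [FiniteDimensional ℝ E]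
    (n : ℕ) (hn : 2 ≤ n)
    (P : E → ((E →L[ℝ] ℝ) [⋀^Fin (n + 1)]→ₗ[ℝ] ℝ)) (hPs : SmoothNV P)
    (hdec : ∀ x : E, ∃ v : Fin (n + 1) → E, ∀ α : Fin (n + 1) → E →L[ℝ] ℝ,
      P x α = Matrix.det (Matrix.of fun i j => α i (v j))) :
    IsNambu P ↔
      ∀ X Y : E → E, ContDiff ℝ (⊤ : ℕ∞) X → ContDiff ℝ (⊤ : ℕ∞) Y →
        (∀ x : E, P x ≠ 0 → X x ∈ Dspan P x) →
        (∀ x : E, P x ≠ 0 → Y x ∈ Dspan P x) →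
        ∀ x : E, P x ≠ 0 →
          fderiv ℝ Y x (X x) - fderiv ℝ X x (Y x) ∈ Dspan P x := by
  classical
  -- the vector fields obtained by contraction
  have hex : ∀ (y : Fin (n+1) → E →L[ℝ] ℝ) (j : Fin (n+1)) (x : E),
      ∃ w : E, ∀ β : E →L[ℝ] ℝ, β w = P x (Function.update y j β) := by
    intro y j x
    obtain ⟨v, hv⟩ := hdec x
    exact exS (P x) v hv y j
  choose S hS using hex
  have hSs : ∀ y j, ContDiff ℝ (⊤ : ℕ∞) (S y j) := by
    intro y j
    refine smooth_of_dual _ fun β => ?_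
    simp only [hS]
    exact hPs _
  have hSd : ∀ y j x, DifferentiableAt ℝ (S y j) x := fun y j x =>
    ((hSs y j).differentiable (by simp)).differentiableAt
  set T : (Fin n → E →L[ℝ] ℝ) → E → E := fun α => S (Fin.snoc α 0) (Fin.last n) with hTdef
  have hT : ∀ α x, ∀ β : E →L[ℝ] ℝ, β (T α x) = P x (Fin.snoc α β) := by
    intro α x β
    rw [hTdef]
    simp only [hS, Fin.update_snoc_last]
  have hTs : ∀ α, ContDiff ℝ (⊤ : ℕ∞) (T α) := fun α => hSs _ _
  have hSD : ∀ y j x, S y j x ∈ Dspan P x := fun y j x =>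
    Dspan_mem P x y j _ (hS y j x) (fun α => T α x) (fun α β => hT α x β)
  have hpd : ∀ y x, DifferentiableAt ℝ (fun z => P z y) x := fun y x =>
    ((hPs y).differentiable (by simp)).differentiableAt
  have hnz : ∀ x, P x ≠ 0 → ∃ y, P x y ≠ 0 := by
    intro x hx
    by_contra hcon
    push Not at hcon
    exact hx (AlternatingMap.ext hcon)
  have hev : ∀ x y, P x y ≠ 0 → ∀ᶠ z in nhds x, P z y ≠ 0 := fun x y h =>
    (hPs y).continuous.continuousAt.eventually_ne h
  have hne : ∀ x y, P x y ≠ 0 → P x ≠ 0 := by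
    intro x y h h0
    exact h (by rw [h0]; rfl)
  have hW : ∀ y x, ∀ j, ∀ β : E →L[ℝ] ℝ, β ((P x y)⁻¹ • S y j x) =
      (P x y)⁻¹ * P x (Function.update y j β) := by
    intro y x j β
    rw [map_smul, hS, smul_eq_mul]
  have hrep : ∀ y x, P x y ≠ 0 → ∀ w ∈ Dspan P x, w = ∑ j, y j w • ((P x y)⁻¹ • S y j x) := by
    intro y x hy w hw
    obtain ⟨v, hv⟩ := hdec x
    exact Dspan_repr P x v hv y hy _ (hW y x) w hw
  constructor
  · intro hN X Y hX hY hXD hYD x hx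
    obtain ⟨y, hy⟩ := hnz x hx
    choose ε α hα using fun j => alt_perm y j
    have hST : ∀ j z, S y j z = ε j • T (α j) z := by
      intro j z
      rw [SeparatingDual.eq_iff_forall_dual_eq (R := ℝ)]
      intro β
      rw [map_smul, smul_eq_mul, hT, hS, hα]
    have hloc : ∀ X : E → E, (∀ x : E, P x ≠ 0 → X x ∈ Dspan P x) →
        X =ᶠ[nhds x] fun z => ∑ j, (y j (X z) * (P z y)⁻¹ * ε j) • T (α j) z := by
      intro X hXD
      filter_upwards [hev x y hy] with z hz
      conv_lhs => rw [hrep y z hz (X z) (hXD z (hne z y hz))]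
      simp only [hST, smul_smul, mul_assoc]
    have hco : ∀ X : E → E, ContDiff ℝ (⊤ : ℕ∞) X → ∀ j,
        DifferentiableAt ℝ (fun z => y j (X z) * (P z y)⁻¹ * ε j) x := by
      intro X hX j
      have h1 : DifferentiableAt ℝ X x := (hX.differentiable (by simp)).differentiableAt
      have h2 : DifferentiableAt ℝ (fun z => y j (X z)) x :=
        (y j).differentiableAt.comp x h1
      exact (h2.mul ((hpd y x).inv hy)).mul_const _
    refine bracket_mem (Dspan P x) x (fun j => T (α j)) _ _ (fun j => hSd _ _ _) (hco X hX)
      (hco Y hY) (fun j => hSD _ _ _) (fun i j => ?_) X Y (hloc X hXD) (hloc Y hYD)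
    rw [nambu_bracket P hN T hT hTs]
    exact Submodule.sum_mem _ fun i _ => hSD _ _ _
  · intro hI f g hf hg
    funext x
    rw [Finset.sum_apply]
    by_cases hx : P x = 0
    · simp [nbr, hx]
    obtain ⟨y, hy⟩ := hnz x hx
    set W : Fin (n+1) → E → E := fun j z => (P z y)⁻¹ • S y j z with hWdef
    have hinv : DifferentiableAt ℝ (fun z => (P z y)⁻¹) x := (hpd y x).inv hy
    have hWd : ∀ j, DifferentiableAt ℝ (W j) x := fun j => hinv.smul (hSd y j x)
    refine fi_at P x (fun z => P z y) W (hpd y x) hWd ?_ ?_ f g hf hg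
    · filter_upwards [hev x y hy] with z hz β
      obtain ⟨v, hv⟩ := hdec z
      exact key_formula (P z) v hv y hz (fun j => W j z) (hW y z) β
    · intro i j
      have hmem : fderiv ℝ (W j) x (W i x) - fderiv ℝ (W i) x (W j x) ∈ Dspan P x := by
        have hc : ∀ i : Fin (n+1), W i =ᶠ[nhds x] fun z => ∑ k, (if k = i then (P z y)⁻¹ else 0) • S y k z := by
          intro i
          filter_upwards with z
          simp [hWdef]
        have hcd : ∀ i k : Fin (n+1), DifferentiableAt ℝ (fun z => if k = i then (P z y)⁻¹ else 0) x := by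
          intro i k
          by_cases h : k = i
          · simpa [h] using hinv
          · simp [h]
        refine bracket_mem (Dspan P x) x (fun k => S y k) _ _ (fun k => hSd y k x) (hcd i) (hcd j)
          (fun k => hSD y k x) (fun a b => ?_) (W i) (W j) (hc i) (hc j)
        exact hI _ _ (hSs y a) (hSs y b) (fun z _ => hSD y a z) (fun z _ => hSD y b z) x hx
      have hz : ∀ k j v, y k (fderiv ℝ (W j) x v) = 0 := by
        intro k j v
        have h1 : fderiv ℝ (fun z => y k (W j z)) x = (y k) ∘L fderiv ℝ (W j) x :=
          ((y k).hasFDerivAt.comp x (hWd j).hasFDerivAt).fderiv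
        have h2 : (fun z => y k (W j z)) =ᶠ[nhds x] fun _ => if j = k then (1 : ℝ) else 0 := by
          filter_upwards [hev x y hy] with z hz
          rw [hWdef]
          simp only [hW]
          by_cases h : j = k
          · subst h; simp [hz]
          · rw [AlternatingMap.map_update_self _ _ h]; simp [h]
        rw [← ContinuousLinearMap.comp_apply, ← h1, h2.fderiv_eq]
        simp
      have := hrep y x hy _ hmem
      simp only [map_sub, hz, sub_zero, zero_smul, Finset.sum_const_zero] at this
      exact sub_eq_zero.1 this
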